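/- arXiv:1412.1876 — 2 statements merged into one kernel-verified Lean document; each statement's English description precedes it below -/
import Mathlib

section
/- Let C and D be abelian categories and let (T^i)_{i ∈ ℤ} be a (-∞,∞) cohomological functor from C to D, that is, a family of additive functors T^i : C → D such that for every short exact sequence 0 → L → M → N → 0 in C there exist connecting morphisms δ^n : T^n(N) → T^{n+1}(L) for all n ∈ ℤ making the long sequence ⋯ → T^{n-1}(N) → T^n(L) → T^n(M) → T^n(N) → T^{n+1}(L) → ⋯ exact, where the unlabeled maps are obtained by applying the functors T^n to the maps of the short exact sequence. Suppose 0 → M_r → M_{r-1} → ⋯ → M_0 → L → 0 is an exact sequence in C and T^i(L) is not a zero object for some i ∈ ℤ. Then T^{i+j}(M_j) is not a zero object for some j with 0 ≤ j ≤ r. -/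
open CategoryTheory CategoryTheory.Limits

/-- If `T` is a `(-∞,∞)` cohomological functor between abelian categories,
`0 → M_r → ⋯ → M_0 → L → 0` is exact and `T^i(L) ≠ 0`, then `T^{i+j}(M_j) ≠ 0`
for some `0 ≤ j ≤ r`. -/
theorem cohomological_functor_nonvanishing
    {C D : Type*} [Category C] [Category D] [Abelian C] [Abelian D]
    (T : ℤ → C ⥤ D) [∀ i, (T i).Additive]
    (hT : ∀ S : ShortComplex C, S.ShortExact →
      ∃ δ : ∀ n : ℤ, (T n).obj S.X₃ ⟶ (T (n + 1)).obj S.X₁,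
        ∀ n : ℤ,
          ∃ (w₁ : (T n).map S.f ≫ (T n).map S.g = 0)
            (w₂ : (T n).map S.g ≫ δ n = 0)
            (w₃ : δ n ≫ (T (n + 1)).map S.f = 0),
            (ShortComplex.mk _ _ w₁).Exact ∧
            (ShortComplex.mk _ _ w₂).Exact ∧
            (ShortComplex.mk _ _ w₃).Exact)
    (r : ℕ) (L : C) (M : ℕ → C)
    (f : ∀ i : ℕ, M (i + 1) ⟶ M i) (g : M 0 ⟶ L)
    (hepi : Epi g)
    (hmono : ∀ _ : 0 < r, Mono (f (r - 1)))
    (hmono0 : r = 0 → Mono g)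
    (w0 : ∀ _ : 0 < r, f 0 ≫ g = 0)
    (ex0 : ∀ h : 0 < r, (ShortComplex.mk (f 0) g (w0 h)).Exact)
    (wi : ∀ i : ℕ, i + 1 < r → f (i + 1) ≫ f i = 0)
    (exi : ∀ (i : ℕ) (h : i + 1 < r), (ShortComplex.mk (f (i + 1)) (f i) (wi i h)).Exact)
    (i : ℤ) (hL : ¬ IsZero ((T i).obj L)) :
    ∃ j : ℕ, j ≤ r ∧ ¬ IsZero ((T (i + j)).obj (M j)) := by
  induction r generalizing i L M with
  | zero =>
    have := hmono0 rfl
    have : IsIso g := isIso_of_mono_of_epi g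
    refine ⟨0, le_rfl, fun h => hL ?_⟩
    rw [Nat.cast_zero, add_zero] at h
    exact h.of_iso ((T i).mapIso (asIso g)).symm
  | succ r ih =>
    by_cases hM : IsZero ((T i).obj (M 0))
    · have hK : ¬ IsZero ((T (i + 1)).obj (kernel g)) := by
        intro hK
        obtain ⟨δ, hδ⟩ := hT (ShortComplex.mk (kernel.ι g) g (kernel.condition g))
          { exact := ShortComplex.exact_kernel g }
        obtain ⟨_, _, _, _, hex, _⟩ := hδ i
        exact hL (hex.isZero_of_both_zeros (hM.eq_of_src _ _) (hK.eq_of_tgt _ _))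
      have hfac : kernel.lift g (f 0) (w0 r.succ_pos) ≫ kernel.ι g = f 0 :=
        kernel.lift_ι _ _ _
      have hw : ∀ h : 0 < r, f 1 ≫ kernel.lift g (f 0) (w0 r.succ_pos) = 0 := fun h => by
        rw [← cancel_mono (kernel.ι g), Category.assoc, hfac, zero_comp]
        exact wi 0 (Nat.succ_lt_succ h)
      obtain ⟨j, hj, hne⟩ := ih (kernel g) (fun n => M (n + 1)) (fun n => f (n + 1))
        (kernel.lift g (f 0) (w0 r.succ_pos)) (ex0 r.succ_pos).epi_kernelLift
        (fun h => by
          obtain ⟨r, rfl⟩ := Nat.exists_eq_succ_of_ne_zero h.ne'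
          exact hmono (Nat.succ_pos _))
        (fun h => by
          subst h
          have : Mono (f 0) := hmono Nat.one_pos
          exact mono_of_mono_fac hfac)
        hw
        (fun h => by
          let φ : ShortComplex.mk (f 1) _ (hw h) ⟶
              ShortComplex.mk (f 1) (f 0) (wi 0 (Nat.succ_lt_succ h)) :=
            { τ₁ := 𝟙 _, τ₂ := 𝟙 _, τ₃ := kernel.ι g }
          have : Epi φ.τ₁ := inferInstanceAs (Epi (𝟙 _))
          have : IsIso φ.τ₂ := inferInstanceAs (IsIso (𝟙 _))
          have : Mono φ.τ₃ := inferInstanceAs (Mono (kernel.ι g))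
          exact (ShortComplex.exact_iff_of_epi_of_isIso_of_mono φ).2
            (exi 0 (Nat.succ_lt_succ h)))
        (fun n h => wi (n + 1) (Nat.succ_lt_succ h))
        (fun n h => exi (n + 1) (Nat.succ_lt_succ h))
        (i + 1) hK
      refine ⟨j + 1, Nat.succ_le_succ hj, ?_⟩
      rwa [Nat.cast_succ, add_comm (j : ℤ) 1, ← add_assoc]
    · exact ⟨0, Nat.zero_le _, by rwa [Nat.cast_zero, add_zero]⟩
end

section
/- The category of profinite groups, whose objects are compact Hausdorff totally disconnected topological groups and whose morphisms are continuous group homomorphisms, has all small colimits. -/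
open CategoryTheory Limits

namespace ProfiniteGrp

universe u

/-- The finite discrete groups whose underlying type is `Fin n` (up to universe lifting),
for some `n`. -/
def finStandard : ObjectProperty ProfiniteGrp.{u} :=
  ObjectProperty.ofObj fun p : Σ n : ℕ, Group (ULift.{u} (Fin n)) ↦
    letI := p.2
    ofFiniteGrp (FiniteGrp.of (ULift.{u} (Fin p.1)))

instance : ObjectProperty.Small.{u} finStandard.{u} := by
  unfold finStandard
  infer_instance

/-- The group structure of a finite group can be transported along any bijection. -/
lemma exists_group_iso_of_equiv {G : FiniteGrp.{u}} {T : Type u} [Finite T] (e : T ≃ G) :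
    ∃ _ : Group T, Nonempty (G ≅ FiniteGrp.of T) := by
  let _ : Group T := e.group
  exact ⟨inferInstance, ⟨{
    hom := FiniteGrp.ofHom e.mulEquiv.symm.toMonoidHom
    inv := FiniteGrp.ofHom e.mulEquiv.toMonoidHom
    hom_inv_id := ConcreteCategory.hom_ext _ _ e.apply_symm_apply
    inv_hom_id := ConcreteCategory.hom_ext _ _ e.symm_apply_apply }⟩⟩

/-- Every finite group is isomorphic to one whose underlying type is `Fin n`. -/
lemma exists_finStandard_iso (G : FiniteGrp.{u}) :
    ∃ K : ProfiniteGrp.{u}, finStandard K ∧ Nonempty (ofFiniteGrp G ≅ K) := by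
  obtain ⟨s, ⟨f⟩⟩ := exists_group_iso_of_equiv
    (Equiv.ulift.{u}.trans (Finite.equivFin G).symm)
  exact ⟨_, ObjectProperty.ofObj_apply _ (⟨Nat.card G, s⟩ :
    Σ n : ℕ, Group (ULift.{u} (Fin n))), ⟨(forget₂ FiniteGrp ProfiniteGrp).mapIso f⟩⟩

/-- Morphisms into a profinite group agree if they agree in all its finite quotients. -/
lemma hom_ext_proj {X Y : ProfiniteGrp.{u}} {f g : X ⟶ Y}
    (h : ∀ U : OpenNormalSubgroup Y, f ≫ proj U = g ≫ proj U) : f = g := by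
  ext x
  apply toLimit_injective Y
  refine limit_ext _ _ _ fun U ↦ ?_
  exact ConcreteCategory.congr_hom (h U) x

lemma isCoseparating_finStandard : (finStandard.{u}).IsCoseparating := by
  intro X Y f g h
  refine hom_ext_proj fun U ↦ ?_
  obtain ⟨K, hK, ⟨e⟩⟩ := exists_finStandard_iso (Y.toFiniteQuotientFunctor.obj U)
  refine (cancel_mono e.hom).1 ?_
  exact (Category.assoc _ _ _).trans ((h K hK (proj U ≫ e.hom)).trans (Category.assoc _ _ _).symm)

/-- The forgetful functor is corepresented by the free profinite group on one generator. -/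
noncomputable def coyonedaCompletionIsoForget :
    coyoneda.obj (Opposite.op (profiniteCompletion.obj
      (GrpCat.of (ULift.{u} (Multiplicative ℤ))))) ≅ forget ProfiniteGrp.{u} :=
  (ProfiniteCompletion.adjunction.corepresentableBy _).toIso ≪≫
    Functor.isoWhiskerLeft (forget₂ ProfiniteGrp GrpCat) GrpCat.coyonedaObjIsoForget

lemma isDetector_completion_int :
    IsDetector (profiniteCompletion.obj (GrpCat.of (ULift.{u} (Multiplicative ℤ)))) :=
  (isDetector_iff_reflectsIsomorphisms_coyoneda_obj _).2
    (reflectsIsomorphisms_of_iso coyonedaCompletionIsoForget.symm)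

instance : HasLimits ProfiniteGrp.{u} where
  has_limits_of_shape _ _ := { }

instance : WellPowered.{u} ProfiniteGrp.{u} :=
  wellPowered_of_isDetector _ isDetector_completion_int

end ProfiniteGrp

/-- The category of profinite groups has all small colimits. -/
theorem profiniteGrp_hasColimits : CategoryTheory.Limits.HasColimits ProfiniteGrp :=
  hasColimits_of_hasLimits_of_isCoseparating ProfiniteGrp.isCoseparating_finStandard
end
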